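/- arXiv:1208.3346 — 2 statements merged into one kernel-verified Lean document; each statement's English description precedes it below -/
import Mathlib

section
/- Let n ≥ 1 and regard each Π_k (k : Fin n) as a matrix over a commutative ring R. Then every Π_k is involutory: Π_k * Π_k = 1 (the identity matrix). -/
open Finset

noncomputable section

/-- The last element of `Fin n` (for `n ≥ 1`). -/
def lastIdx (n : ℕ) (hn : 1 ≤ n) : Fin n := ⟨n - 1, by omega⟩

/-- The even-cardinality subsets of `Fin n`, indexing the rows and columns of the
partition matrix. -/
abbrev EvenSets (n : ℕ) := {S : Finset (Fin n) // Even S.card}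

/-- The partition matrix `Π(w)`: its `(S, S')` entry is `w k` if
`S Δ S' Δ {ℓ}` is the singleton `{k}` (where `ℓ` is the last element of `Fin n`),
and `0` otherwise. -/
def partitionMatrix {R : Type*} [CommRing R] (n : ℕ) (hn : 1 ≤ n) (w : Fin n → R) :
    Matrix (EvenSets n) (EvenSets n) R :=
  Matrix.of fun S S' : EvenSets n =>
    ∑ k : Fin n,
      if symmDiff (symmDiff S.1 S'.1) {lastIdx n hn} = {k} then w k else 0

/-- The 0/1 matrix `Π_k`: its `(S, S')` entry is `1` if `S Δ S' Δ {ℓ} = {k}`,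
and `0` otherwise. -/
def PiPerm (n : ℕ) (hn : 1 ≤ n) (R : Type*) [CommRing R] (k : Fin n) :
    Matrix (EvenSets n) (EvenSets n) R :=
  Matrix.of fun S S' : EvenSets n =>
    if symmDiff (symmDiff S.1 S'.1) {lastIdx n hn} = {k} then 1 else 0

theorem Finset.even_card_symmDiff {α : Type*} [DecidableEq α] {s t : Finset α}
    (hs : Even s.card) (ht : Even t.card) : Even (symmDiff s t).card := by
  have hsymm : (symmDiff s t).card = (s \ t).card + (t \ s).card :=
    Finset.card_union_of_disjoint disjoint_sdiff_sdiff
  have hst := Finset.card_sdiff_add_card_inter s t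
  have hts := Finset.card_sdiff_add_card_inter t s
  rw [Finset.inter_comm t s] at hts
  grind

theorem Finset.even_card_symmDiff_singleton {α : Type*} [DecidableEq α] (a b : α) :
    Even (symmDiff ({a} : Finset α) {b}).card := by
  by_cases h : a = b
  · simp [h]
  · rw [(symmDiff_eq_sup _ _).mpr (by simpa using h)]
    simp [Finset.card_pair h]

/-- The involution `S ↦ S Δ {ℓ} Δ {k}` of the even-cardinality subsets. -/
def EvenSets.toggle (n : ℕ) (hn : 1 ≤ n) (k : Fin n) (S : EvenSets n) : EvenSets n :=
  ⟨symmDiff S.1 (symmDiff {lastIdx n hn} {k}),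
    Finset.even_card_symmDiff S.2 (Finset.even_card_symmDiff_singleton _ _)⟩

theorem EvenSets.toggle_toggle (n : ℕ) (hn : 1 ≤ n) (k : Fin n) (S : EvenSets n) :
    toggle n hn k (toggle n hn k S) = S :=
  Subtype.ext (symmDiff_symmDiff_cancel_right _ _)

theorem EvenSets.eq_toggle_iff (n : ℕ) (hn : 1 ≤ n) (k : Fin n) (S S' : EvenSets n) :
    symmDiff (symmDiff S.1 S'.1) {lastIdx n hn} = {k} ↔ S' = toggle n hn k S := by
  rw [Subtype.ext_iff]
  simp only [toggle, Finset.ext_iff, Finset.mem_symmDiff]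
  exact forall_congr' fun _ => by tauto

theorem PiPerm_apply (n : ℕ) (hn : 1 ≤ n) (R : Type*) [CommRing R] (k : Fin n)
    (S S' : EvenSets n) :
    PiPerm n hn R k S S' = if S' = EvenSets.toggle n hn k S then 1 else 0 := by
  simp only [PiPerm, Matrix.of_apply, EvenSets.eq_toggle_iff]

theorem stmt_11 (n : ℕ) (hn : 1 ≤ n) (R : Type*) [CommRing R] (k : Fin n) :
    PiPerm n hn R k * PiPerm n hn R k = 1 := by
  ext S S'
  simp only [Matrix.mul_apply, Matrix.one_apply, PiPerm_apply, ite_mul, one_mul, zero_mul,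
    Finset.sum_ite_eq', Finset.mem_univ, if_true, EvenSets.toggle_toggle, eq_comm (a := S')]
end
end

section
/- Let n ≥ 1 and w : Fin n → ℝ. The characteristic polynomial of the partition matrix Π(w) factors completely into linear factors indexed by sign vectors: charpoly(Π(w)) = ∏_{s : Fin (n−1) → ℝ, s i ∈ {−1, 1} for all i} ( X − C( (∑_{i : Fin (n−1)} s i * w (i.castSucc)) + w ℓ ) ) in ℝ[X]. -/
open Finset

noncomputable section

/-- The character of the group of subsets of `Fin (m + 1)` under symmetric difference that is
attached to the sign vector `(s, 1)`. -/
def signChar {m : ℕ} (s : Fin m → ℤˣ) (S : Finset (Fin (m + 1))) : ℤˣ :=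
  ∏ i : Fin m, if i.castSucc ∈ S then s i else 1

lemma signChar_symmDiff {m : ℕ} (s : Fin m → ℤˣ) (S T : Finset (Fin (m + 1))) :
    signChar s (symmDiff S T) = signChar s S * signChar s T := by
  rw [signChar, signChar, signChar, ← prod_mul_distrib]
  refine prod_congr rfl fun i _ => ?_
  by_cases hS : i.castSucc ∈ S <;> by_cases hT : i.castSucc ∈ T <;>
    simp [mem_symmDiff, hS, hT]

lemma signChar_singleton_last {m : ℕ} (s : Fin m → ℤˣ) : signChar s {Fin.last m} = 1 := by
  simp [signChar, (Fin.castSucc_lt_last _).ne]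

lemma signChar_singleton_castSucc {m : ℕ} (s : Fin m → ℤˣ) (i : Fin m) :
    signChar s {i.castSucc} = s i := by
  simp [signChar]

lemma even_card_symmDiff {α : Type*} [DecidableEq α] {S T : Finset α} :
    Even (symmDiff S T).card ↔ (Even S.card ↔ Even T.card) := by
  have hd : (symmDiff S T).card = (S \ T).card + (T \ S).card :=
    card_union_of_disjoint disjoint_sdiff_sdiff
  have h₁ := card_sdiff_add_card_inter S T
  have h₂ := card_sdiff_add_card_inter T S
  rw [inter_comm T S] at h₂
  rw [← h₁, ← h₂, hd]
  simp only [Nat.even_add]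
  tauto

lemma evenSets_ext {m : ℕ} {S T : EvenSets (m + 1)}
    (h : ∀ i : Fin m, i.castSucc ∈ S.1 ↔ i.castSucc ∈ T.1) : S = T := by
  have hsub : symmDiff S.1 T.1 ⊆ {Fin.last m} := by
    intro x hx
    induction x using Fin.lastCases with
    | last => simp
    | cast i => simp [mem_symmDiff, h i] at hx
  have heven : Even (symmDiff S.1 T.1).card :=
    even_card_symmDiff.2 (iff_of_true S.2 T.2)
  rcases subset_singleton_iff.1 hsub with h0 | h1
  · exact Subtype.ext (symmDiff_eq_bot.1 h0)
  · simp [h1] at heven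

/-- The sign vector recording membership of all but the last element. -/
def evenSetSign {m : ℕ} (S : EvenSets (m + 1)) (i : Fin m) : ℤˣ :=
  if i.castSucc ∈ S.1 then -1 else 1

lemma evenSetSign_bijective (m : ℕ) :
    Function.Bijective (evenSetSign : EvenSets (m + 1) → Fin m → ℤˣ) := by
  refine ⟨fun S T h => evenSets_ext fun i => ?_, fun s => ?_⟩
  · have hi := congrFun h i
    by_cases hS : i.castSucc ∈ S.1 <;> by_cases hT : i.castSucc ∈ T.1 <;>
      simp_all [evenSetSign]
  · let A : Finset (Fin (m + 1)) := (univ.filter fun i => s i = -1).map Fin.castSuccEmb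
    have hA (i : Fin m) : i.castSucc ∈ A ↔ s i = -1 := by simp [A]
    have hval (i : Fin m) : (if s i = -1 then -1 else 1) = s i := by
      rcases Int.units_eq_one_or (s i) with h | h <;> simp [h]
    by_cases hE : Even A.card
    · exact ⟨⟨A, hE⟩, funext fun i => by simp [evenSetSign, hA, hval]⟩
    · refine ⟨⟨symmDiff A {Fin.last m}, even_card_symmDiff.2 (iff_of_false hE (by simp))⟩,
        funext fun i => ?_⟩
      simp [evenSetSign, mem_symmDiff, hA, hval, (Fin.castSucc_lt_last i).ne]

/-- Even subsets of `Fin (m + 1)` correspond to sign vectors of length `m`. -/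
def evenSetsEquiv (m : ℕ) : EvenSets (m + 1) ≃ (Fin m → ℤˣ) :=
  Equiv.ofBijective evenSetSign (evenSetSign_bijective m)

lemma sum_signChar_mul_signChar {m : ℕ} (S T : EvenSets (m + 1)) :
    ∑ s : Fin m → ℤˣ, ((signChar s S.1 : ℤ) : ℝ) * ((signChar s T.1 : ℤ) : ℝ) =
      if S = T then 2 ^ m else 0 := by
  have key : ∀ s : Fin m → ℤˣ, ((signChar s S.1 : ℤ) : ℝ) * ((signChar s T.1 : ℤ) : ℝ) =
      ∏ i : Fin m,
        (if (i.castSucc ∈ S.1 ↔ i.castSucc ∈ T.1) then 1 else ((s i : ℤ) : ℝ)) := by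
    intro s
    rw [← Int.cast_mul, ← Units.val_mul, ← signChar_symmDiff, signChar, Units.coe_prod,
      Int.cast_prod]
    refine prod_congr rfl fun i _ => ?_
    by_cases hS : i.castSucc ∈ S.1 <;> by_cases hT : i.castSucc ∈ T.1 <;>
      simp [mem_symmDiff, hS, hT]
  simp_rw [key]
  rw [← Fintype.prod_sum (fun (i : Fin m) (u : ℤˣ) =>
    if (i.castSucc ∈ S.1 ↔ i.castSucc ∈ T.1) then (1 : ℝ) else ((u : ℤ) : ℝ))]
  split_ifs with h
  · subst h
    simp
  · obtain ⟨i, hi⟩ : ∃ i : Fin m, ¬(i.castSucc ∈ S.1 ↔ i.castSucc ∈ T.1) := by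
      by_contra! hc
      exact h (evenSets_ext hc)
    refine prod_eq_zero (mem_univ i) ?_
    simp [hi, UnitsInt.univ]

lemma symmDiff_singleton_eq_iff {α : Type*} [DecidableEq α] (S T : Finset α) (a b : α) :
    symmDiff (symmDiff S T) {a} = {b} ↔ T = symmDiff S (symmDiff {a} {b}) := by
  constructor
  · intro h
    rw [← h, symmDiff_comm _ ({a} : Finset α), symmDiff_symmDiff_cancel_left, symmDiff_symmDiff_cancel_left]
  · rintro rfl
    rw [symmDiff_symmDiff_cancel_left, symmDiff_comm, symmDiff_symmDiff_cancel_left]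

lemma sum_partitionMatrix_mul_signChar {m : ℕ} (hn : 1 ≤ m + 1) (w : Fin (m + 1) → ℝ)
    (s : Fin m → ℤˣ) (S : EvenSets (m + 1)) :
    ∑ T : EvenSets (m + 1), partitionMatrix (m + 1) hn w S T * ((signChar s T.1 : ℤ) : ℝ) =
      ((signChar s S.1 : ℤ) : ℝ) *
        (∑ i : Fin m, ((s i : ℤ) : ℝ) * w i.castSucc + w (Fin.last m)) := by
  have hl : lastIdx (m + 1) hn = Fin.last m := rfl
  simp only [partitionMatrix, Matrix.of_apply, hl, sum_mul]
  rw [sum_comm]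
  have key (k : Fin (m + 1)) :
      ∑ T : EvenSets (m + 1),
        (if symmDiff (symmDiff S.1 T.1) {Fin.last m} = {k} then w k else 0) *
          ((signChar s T.1 : ℤ) : ℝ) =
      ((signChar s S.1 : ℤ) : ℝ) * (((signChar s {k} : ℤ) : ℝ) * w k) := by
    let T₀ : EvenSets (m + 1) := ⟨symmDiff S.1 (symmDiff {Fin.last m} {k}),
      even_card_symmDiff.2 (iff_of_true S.2 (even_card_symmDiff.2 (by simp)))⟩
    have hiff (T : EvenSets (m + 1)) :
        symmDiff (symmDiff S.1 T.1) {Fin.last m} = {k} ↔ T = T₀ := by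
      rw [symmDiff_singleton_eq_iff, Subtype.ext_iff]
    simp only [hiff, ite_mul, zero_mul, sum_ite_eq', mem_univ, if_true]
    simp only [T₀, signChar_symmDiff, signChar_singleton_last, one_mul]
    push_cast
    ring
  simp_rw [key]
  rw [← mul_sum, Fin.sum_univ_castSucc]
  simp [signChar_singleton_last, signChar_singleton_castSucc]

theorem stmt_17 (n : ℕ) (hn : 1 ≤ n) (w : Fin n → ℝ) :
    (partitionMatrix n hn w).charpoly =
      ∏ s : Fin (n - 1) → ℤˣ,
        (Polynomial.X -
          Polynomial.C
            ((∑ i : Fin (n - 1), ((s i : ℤ) : ℝ) * w (Fin.castLE (by omega) i)) +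
              w (lastIdx n hn))) := by
  obtain ⟨m, rfl⟩ : ∃ m, n = m + 1 := ⟨n - 1, by omega⟩
  let ev (s : Fin m → ℤˣ) : ℝ :=
    ∑ i : Fin m, ((s i : ℤ) : ℝ) * w i.castSucc + w (Fin.last m)
  change _ = ∏ s : Fin m → ℤˣ, (Polynomial.X - Polynomial.C (ev s))
  let e := evenSetsEquiv m
  let H : Matrix (EvenSets (m + 1)) (EvenSets (m + 1)) ℝ :=
    Matrix.of fun S T => ((signChar (e T) S.1 : ℤ) : ℝ)
  let D : Matrix (EvenSets (m + 1)) (EvenSets (m + 1)) ℝ := Matrix.diagonal (ev ∘ e)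
  have hH : H * (((2 : ℝ) ^ m)⁻¹ • H.transpose) = 1 := by
    ext S T
    rw [Matrix.mul_smul, Matrix.smul_apply, Matrix.mul_apply]
    simp only [H, Matrix.transpose_apply, Matrix.of_apply]
    rw [Equiv.sum_comp e fun s => ((signChar s S.1 : ℤ) : ℝ) * ((signChar s T.1 : ℤ) : ℝ),
      sum_signChar_mul_signChar, Matrix.one_apply]
    split_ifs <;> simp
  have hHD : partitionMatrix (m + 1) hn w * H = H * D := by
    ext S T
    rw [Matrix.mul_diagonal, Matrix.mul_apply]
    exact sum_partitionMatrix_mul_signChar hn w (e T) S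
  let U : (Matrix (EvenSets (m + 1)) (EvenSets (m + 1)) ℝ)ˣ :=
    ⟨H, ((2 : ℝ) ^ m)⁻¹ • H.transpose, hH, mul_eq_one_comm.1 hH⟩
  have hconj : partitionMatrix (m + 1) hn w = U.val * D * U.val⁻¹ := by
    rw [← Matrix.coe_units_inv, Units.eq_mul_inv_iff_mul_eq]
    exact hHD
  rw [hconj, Matrix.charpoly_units_conj, Matrix.charpoly_diagonal]
  exact Equiv.prod_comp e fun s => Polynomial.X - Polynomial.C (ev s)
end
end
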